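/- Let μ = l_1 + l_2 + l_3 be a Lie 2-algebra structure on a graded vector space E = E_{−2} ⊕ E_{−1} concentrated in degrees −2 and −1, and let α be a symmetric vector valued 2-form of degree 0 on E. Then S + α is a Nijenhuis vector valued form with respect to μ with square S + 2α if and only if α(l_1(α(X,Y)),Z) + α(l_1(α(Y,Z)),X) + α(l_1(α(Z,X)),Y) = 0 for all X, Y, Z ∈ E_{−1}. -/

import Mathlib

open scoped DirectSum
open Classical

noncomputable section

namespace RN

section Core

variable (𝕜 : Type) [Field 𝕜] [CharZero 𝕜]
variable (E : ℤ → Type) [∀ i, AddCommGroup (E i)] [∀ i, Module 𝕜 (E i)]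

/-- Raw vector-valued forms on the graded vector space `E`: for every arity `n` and every
vector of (input) degrees `ι`, a function on homogeneous tuples with values in the total
graded space `⨁ i, E i`. -/
abbrev RawForm : Type :=
  ∀ n : ℕ, ∀ ι : Fin n → ℤ, (∀ j, E (ι j)) → ⨁ i, E i

/-- Multilinearity (in each slot, on homogeneous arguments). -/
def IsMultilin (F : RawForm E) : Prop :=
  ∀ (n : ℕ) (ι : Fin n → ℤ) (x : ∀ j, E (ι j)) (j : Fin n) (a b : E (ι j)) (c : 𝕜),
    F n ι (Function.update x j (a + b)) =
        F n ι (Function.update x j a) + F n ι (Function.update x j b) ∧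
      F n ι (Function.update x j (c • a)) = c • F n ι (Function.update x j a)

/-- Graded symmetry: swapping two adjacent homogeneous arguments multiplies the value
by the Koszul sign `(-1)^{|X||Y|}`. -/
def IsGradedSym (F : RawForm E) : Prop :=
  ∀ (n : ℕ) (ι : Fin n → ℤ) (x : ∀ j, E (ι j)) (p q : Fin n), (p : ℕ) + 1 = (q : ℕ) →
    F n (fun j => ι (Equiv.swap p q j)) (fun j => x (Equiv.swap p q j)) =
      ((-1 : 𝕜) ^ (ι p * ι q)) • F n ι x

/-- `F` has degree `d`: its value on homogeneous arguments of degrees `ι` is homogeneous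
of degree `(∑ j, ι j) + d`. -/
def IsOfDeg (d : ℤ) (F : RawForm E) : Prop :=
  ∀ (n : ℕ) (ι : Fin n → ℤ) (x : ∀ j, E (ι j)) (m : ℤ),
    m ≠ (∑ j, ι j) + d → F n ι x m = 0

/-- Symmetric vector valued form of degree `d`. -/
def IsSVF (d : ℤ) (F : RawForm E) : Prop :=
  IsMultilin 𝕜 E F ∧ IsGradedSym 𝕜 E F ∧ IsOfDeg E d F

/-- `F` is (concentrated in) a `k`-form. -/
def IsArity (k : ℕ) (F : RawForm E) : Prop :=
  ∀ n, n ≠ k → ∀ (ι : Fin n → ℤ) (x : ∀ j, E (ι j)), F n ι x = 0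

/-- `F` has no 0-form (curvature) component. -/
def NoCurv (F : RawForm E) : Prop :=
  ∀ (ι : Fin 0 → ℤ) (x : ∀ j, E (ι j)), F 0 ι x = 0

/-- `(k, n-k)`-shuffles of `Fin n`. -/
def IsShuffle (k : ℕ) {n : ℕ} (σ : Equiv.Perm (Fin n)) : Prop :=
  ∀ i j : Fin n, i < j → ((j : ℕ) < k ∨ k ≤ (i : ℕ)) → σ i < σ j

/-- The Koszul sign of the rearrangement `(X_{σ(1)},…,X_{σ(n)})` of homogeneous elements
of degrees `ι`. -/
def koszulSign {n : ℕ} (ι : Fin n → ℤ) (σ : Equiv.Perm (Fin n)) : 𝕜 :=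
  ∏ p ∈ Finset.univ.filter (fun p : Fin n × Fin n => p.1 < p.2 ∧ σ p.2 < σ p.1),
    (-1 : 𝕜) ^ (ι (σ p.1) * ι (σ p.2))

/-- Prepend a degree to a vector of degrees. -/
def dcons {n : ℕ} (m : ℤ) (rest : Fin n → ℤ) : Fin (n + 1) → ℤ :=
  fun j => if h : (j : ℕ) = 0 then m else rest ⟨(j : ℕ) - 1, by have := j.isLt; omega⟩

/-- Prepend a homogeneous element to a tuple of homogeneous elements. -/
def dconsV {n : ℕ} {m : ℤ} {rest : Fin n → ℤ} (v : E m) (xs : ∀ i, E (rest i)) :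
    ∀ j : Fin (n + 1), E (dcons m rest j) := fun j => by
  unfold dcons
  by_cases h : (j : ℕ) = 0
  · rw [dif_pos h]; exact v
  · rw [dif_neg h]; exact xs ⟨(j : ℕ) - 1, by have := j.isLt; omega⟩

/-- The insertion operator `ι_F G`, summing over shuffles with Koszul signs. -/
def ins (F G : RawForm E) : RawForm E :=
  fun n ι x =>
    ∑ k : Fin (n + 1),
      ∑ σ ∈ Finset.univ.filter (fun σ : Equiv.Perm (Fin n) => IsShuffle (k : ℕ) σ),
        koszulSign 𝕜 ι σ •
          DFinsupp.sum
            (F (k : ℕ)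
              (fun i => ι (σ ⟨(i : ℕ), by have h1 := i.isLt; have h2 := k.isLt; omega⟩))
              (fun i => x (σ ⟨(i : ℕ), by have h1 := i.isLt; have h2 := k.isLt; omega⟩)))
            (fun m v =>
              G (n - (k : ℕ) + 1)
                (dcons m
                  (fun i => ι (σ ⟨(k : ℕ) + (i : ℕ), by have h1 := i.isLt; have h2 := k.isLt; omega⟩)))
                (dconsV E v
                  (fun i => x (σ ⟨(k : ℕ) + (i : ℕ), by have h1 := i.isLt; have h2 := k.isLt; omega⟩))))

/-- The Richardson–Nijenhuis bracket `[F,G]_RN = ι_F G - (-1)^{dK·dL} ι_G F` of forms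
of degrees `dK` and `dL`. -/
def rnb (dK dL : ℤ) (F G : RawForm E) : RawForm E :=
  fun n ι x => ins 𝕜 E F G n ι x - ((-1 : 𝕜) ^ (dK * dL)) • ins 𝕜 E G F n ι x

/-- An element of the graded vector space, regarded as a vector valued 0-form. -/
def ofElem (v : ⨁ i, E i) : RawForm E := fun n _ _ => if n = 0 then v else 0

/-- The Euler map `S(X) = -|X|·X`, a vector valued 1-form of degree 0. -/
def euler : RawForm E :=
  fun n ι x =>
    if h : n = 1 then
      (-(ι ⟨0, by omega⟩)) • DirectSum.of E (ι ⟨0, by omega⟩) (x ⟨0, by omega⟩)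
    else 0

/-- The identity map of `E`, regarded as a vector valued 1-form of degree 0. -/
def idF : RawForm E :=
  fun n ι x =>
    if h : n = 1 then DirectSum.of E (ι ⟨0, by omega⟩) (x ⟨0, by omega⟩) else 0

/-- The arity-`k` component of a vector valued form. -/
def comp (F : RawForm E) (k : ℕ) : RawForm E :=
  fun n ι x => if n = k then F n ι x else 0

end Core

/-- A symmetric vector valued 2-form `α` of degree 0 on a graded vector space concentrated
in degrees `-2, -1`, evaluated on `X, Y ∈ E_{-1}` (the value lies in `E_{-2}`). -/
def a2 (E : ℤ → Type) [∀ i, AddCommGroup (E i)] (α : RawForm E) (X Y : E (-1)) : E (-2) :=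
  α 2 (fun _ => (-1 : ℤ)) (fun j => if (j : ℕ) = 0 then X else Y) (-2)

/-- A symmetric vector valued 1-form `l₁` of degree `+1`, evaluated on `v ∈ E_{-2}`
(the value lies in `E_{-1}`). -/
def d1 (E : ℤ → Type) [∀ i, AddCommGroup (E i)] (l1 : RawForm E) (v : E (-2)) : E (-1) :=
  l1 1 (fun _ => (-2 : ℤ)) (fun _ => v) (-1)

section Evaluation

set_option linter.unusedSectionVars false

variable (𝕜 : Type) [Field 𝕜]
variable {E : ℤ → Type} [∀ i, AddCommGroup (E i)] [∀ i, Module 𝕜 (E i)]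

/-- Evaluation of a raw form on a tuple of homogeneous elements bundled with their degrees. -/
def ev (F : RawForm E) {n : ℕ} (y : Fin n → Σ i, E i) : ⨁ i, E i :=
  F n (fun j => (y j).1) (fun j => (y j).2)

/-- Evaluation of `G` with a (not necessarily homogeneous) first argument `f`. -/
def ap (G : RawForm E) (f : ⨁ i, E i) {n : ℕ} (rest : Fin n → Σ i, E i) : ⨁ i, E i :=
  DFinsupp.sum f fun m v => ev G (Fin.cons (⟨m, v⟩ : Σ i, E i) rest : Fin (n + 1) → Σ i, E i)

/-- The contribution of `(k, n-k)`-shuffles to `ins F G`. -/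
def insPart (F G : RawForm E) {n : ℕ} (y : Fin n → Σ i, E i) (k : ℕ) (hk : k ≤ n) :
    ⨁ i, E i :=
  ∑ σ ∈ Finset.univ.filter (fun σ : Equiv.Perm (Fin n) => IsShuffle k σ),
    koszulSign 𝕜 (fun j => (y j).1) σ •
      ap G (ev F (fun i : Fin k => y (σ ⟨i, i.isLt.trans_le hk⟩)))
        (fun i : Fin (n - k) => y (σ ⟨k + i, by have := i.isLt; omega⟩))

theorem sigma_dcons {n : ℕ} {m : ℤ} {rest : Fin n → ℤ} (v : E m) (xs : ∀ i, E (rest i)) :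
    (fun j => (⟨dcons m rest j, dconsV E v xs j⟩ : Σ i, E i)) =
      (Fin.cons (⟨m, v⟩ : Σ i, E i) (fun i => ⟨rest i, xs i⟩) : Fin (n + 1) → Σ i, E i) := by
  funext j
  exact Fin.cases rfl (fun _ => rfl) j

theorem ev_ins (F G : RawForm E) {n : ℕ} (y : Fin n → Σ i, E i) :
    ev (ins 𝕜 E F G) y =
      ∑ k : Fin (n + 1), insPart 𝕜 F G y k (Nat.lt_succ_iff.mp k.isLt) := by
  unfold ev ins insPart
  refine Finset.sum_congr rfl fun k _ => Finset.sum_congr rfl fun σ _ => ?_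
  congr 1
  unfold ap
  congr 1
  funext m v
  rw [← sigma_dcons]
  rfl

theorem form_ext {F G : RawForm E}
    (h : ∀ (n : ℕ) (y : Fin n → Σ i, E i), ev F y = ev G y) : F = G := by
  funext n ι x
  exact h n fun j => ⟨ι j, x j⟩

@[simp] theorem ev_add (F G : RawForm E) {n : ℕ} (y : Fin n → Σ i, E i) :
    ev (F + G) y = ev F y + ev G y := rfl

@[simp] theorem ev_zero {n : ℕ} (y : Fin n → Σ i, E i) : ev (0 : RawForm E) y = 0 := rfl

theorem ev_rnb (a b : ℤ) (F G : RawForm E) {n : ℕ} (y : Fin n → Σ i, E i) :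
    ev (rnb 𝕜 E a b F G) y =
      ev (ins 𝕜 E F G) y - ((-1 : 𝕜) ^ (a * b)) • ev (ins 𝕜 E G F) y := rfl

@[simp] theorem ap_zero (G : RawForm E) {n : ℕ} (rest : Fin n → Σ i, E i) :
    ap G 0 rest = 0 := DFinsupp.sum_zero_index

theorem ap_add_form (G H : RawForm E) (f : ⨁ i, E i) {n : ℕ} (rest : Fin n → Σ i, E i) :
    ap (G + H) f rest = ap G f rest + ap H f rest := DFinsupp.sum_add

/-- `F` vanishes on fewer than `p` arguments. -/
def LowZero (p : ℕ) (F : RawForm E) : Prop :=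
  ∀ n, n < p → ∀ y : Fin n → Σ i, E i, ev F y = 0

/-- `F` vanishes as soon as one argument has degree other than `-2` and `-1`. -/
def Conc (F : RawForm E) : Prop :=
  ∀ (n : ℕ) (y : Fin n → Σ i, E i) (j : Fin n), (y j).1 ≠ -2 → (y j).1 ≠ -1 → ev F y = 0

/-- `F` is additive in its first argument. -/
def AddHead (F : RawForm E) : Prop :=
  ∀ (n : ℕ) (m : ℤ) (a b : E m) (rest : Fin n → Σ i, E i),
    ev F (Fin.cons (⟨m, a + b⟩ : Σ i, E i) rest : Fin (n + 1) → Σ i, E i) =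
      ev F (Fin.cons (⟨m, a⟩ : Σ i, E i) rest : Fin (n + 1) → Σ i, E i) +
        ev F (Fin.cons (⟨m, b⟩ : Σ i, E i) rest : Fin (n + 1) → Σ i, E i)

section AddHead

variable {𝕜} {G : RawForm E} (hG : AddHead G)
include hG

theorem AddHead.zero {n : ℕ} (m : ℤ) (rest : Fin n → Σ i, E i) :
    ev G (Fin.cons (⟨m, 0⟩ : Σ i, E i) rest : Fin (n + 1) → Σ i, E i) = 0 := by
  have h := hG n m 0 0 rest
  rw [add_zero] at h
  exact left_eq_add.mp h

theorem AddHead.ap_add {n : ℕ} (f g : ⨁ i, E i) (rest : Fin n → Σ i, E i) :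
    ap G (f + g) rest = ap G f rest + ap G g rest :=
  DFinsupp.sum_add_index (fun _ => hG.zero _ _) (fun _ _ _ => hG _ _ _ _ _)

theorem AddHead.ap_neg {n : ℕ} (f : ⨁ i, E i) (rest : Fin n → Σ i, E i) :
    ap G (-f) rest = -ap G f rest := by
  refine eq_neg_of_add_eq_zero_left ?_
  rw [← hG.ap_add, neg_add_cancel, ap_zero]

theorem AddHead.ap_zsmul {n : ℕ} (c : ℤ) (f : ⨁ i, E i) (rest : Fin n → Σ i, E i) :
    ap G (c • f) rest = c • ap G f rest :=
  map_zsmul (AddMonoidHom.mk' (fun f => ap G f rest) fun f g => hG.ap_add f g rest) c f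

theorem AddHead.ap_of {n : ℕ} (m : ℤ) (v : E m) (rest : Fin n → Σ i, E i) :
    ap G (DirectSum.of E m v) rest =
      ev G (Fin.cons (⟨m, v⟩ : Σ i, E i) rest : Fin (n + 1) → Σ i, E i) :=
  DFinsupp.sum_single_index (hG.zero _ _)

end AddHead

theorem AddHead.add {F G : RawForm E} (hF : AddHead F) (hG : AddHead G) : AddHead (F + G) := by
  intro n m a b rest
  simp only [ev_add, hF n m a b rest, hG n m a b rest]
  abel

theorem ins_add_right (F G H : RawForm E) :
    ins 𝕜 E F (G + H) = ins 𝕜 E F G + ins 𝕜 E F H := by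
  refine form_ext fun n y => ?_
  simp only [ev_add, ev_ins, insPart, ap_add_form, smul_add, Finset.sum_add_distrib]

theorem ins_add_left (F F' : RawForm E) {G : RawForm E} (hG : AddHead G) :
    ins 𝕜 E (F + F') G = ins 𝕜 E F G + ins 𝕜 E F' G := by
  refine form_ext fun n y => ?_
  simp only [ev_add, ev_ins, insPart, hG.ap_add, smul_add, Finset.sum_add_distrib]

theorem LowZero.ins {p q : ℕ} {F G : RawForm E} (hF : LowZero p F) (hG : LowZero q G) :
    LowZero (p + q - 1) (ins 𝕜 E F G) := by
  intro n hn y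
  rw [ev_ins]
  refine Finset.sum_eq_zero fun k _ => Finset.sum_eq_zero fun σ _ => ?_
  rcases lt_or_ge (k : ℕ) p with hk | hk
  · rw [hF _ hk, ap_zero, smul_zero]
  · have : ∀ z : Fin (n - k + 1) → Σ i, E i, ev G z = 0 := hG _ (by omega)
    simp [ap, this, DFinsupp.sum]

theorem Conc.ins {F G : RawForm E} (hF : Conc F) (hG : Conc G) : Conc (ins 𝕜 E F G) := by
  intro n y j h2 h1
  rw [ev_ins]
  refine Finset.sum_eq_zero fun k _ => Finset.sum_eq_zero fun σ _ => ?_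
  obtain ⟨i, rfl⟩ := σ.surjective j
  rcases lt_or_ge (i : ℕ) k with hk | hk
  · rw [hF _ _ ⟨i, hk⟩ h2 h1, ap_zero, smul_zero]
  · have hi : (⟨(k : ℕ) + (i - k), by omega⟩ : Fin n) = i := Fin.ext (by simp; omega)
    have : ∀ m (v : E m), ev G (Fin.cons (⟨m, v⟩ : Σ i, E i)
        (fun i : Fin (n - k) => y (σ ⟨k + i, by have := i.isLt; omega⟩)) :
          Fin (n - k + 1) → Σ i, E i) = 0 := fun m v =>
      hG _ _ (Fin.succ ⟨i - k, by omega⟩) (by rw [Fin.cons_succ]; simpa [hi] using h2)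
        (by rw [Fin.cons_succ]; simpa [hi] using h1)
    simp [ap, this, DFinsupp.sum]

theorem isOfDeg_ev {F : RawForm E} {d : ℤ} (hF : IsOfDeg E d F) {n : ℕ} (y : Fin n → Σ i, E i)
    {m : ℤ} (hm : m ≠ (∑ j, (y j).1) + d) : ev F y m = 0 := hF _ _ _ _ hm

theorem sum_fin_split {n k : ℕ} (hk : k ≤ n) (f : Fin n → ℤ) :
    (∑ i : Fin k, f ⟨i, i.isLt.trans_le hk⟩) +
      ∑ i : Fin (n - k), f ⟨k + i, by have := i.isLt; omega⟩ = ∑ j, f j := by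
  obtain ⟨r, rfl⟩ := Nat.exists_eq_add_of_le hk
  rw [Fin.sum_univ_add]
  congr 1
  exact Fintype.sum_equiv (finCongr (by omega)) _ _ fun i => rfl

theorem isOfDeg_ins {F G : RawForm E} {a b : ℤ} (hF : IsOfDeg E a F) (hG : IsOfDeg E b G) :
    IsOfDeg E (a + b) (ins 𝕜 E F G) := by
  intro n ι x m hm
  change ev (ins 𝕜 E F G) (fun j => (⟨ι j, x j⟩ : Σ i, E i)) m = 0
  rw [ev_ins, DFinsupp.finsetSum_apply]
  refine Finset.sum_eq_zero fun k _ => ?_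
  rw [insPart, DFinsupp.finsetSum_apply]
  refine Finset.sum_eq_zero fun σ _ => ?_
  rw [DirectSum.smul_apply, ap, DFinsupp.sum, DFinsupp.finsetSum_apply, Finset.sum_eq_zero,
    smul_zero]
  intro i hi
  refine isOfDeg_ev hG _ ?_
  have hi' : i = (∑ j : Fin k, ι (σ ⟨j, j.isLt.trans_le (Nat.lt_succ_iff.mp k.isLt)⟩)) + a := by
    by_contra hne
    exact DFinsupp.mem_support_iff.mp hi (isOfDeg_ev hF _ hne)
  rw [Fin.sum_univ_succ]
  simp only [Fin.cons_zero, Fin.cons_succ]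
  have := sum_fin_split (Nat.lt_succ_iff.mp k.isLt) (fun j => ι (σ j))
  rw [Equiv.sum_comp σ ι] at this
  intro h
  exact hm (by rw [h, hi']; linear_combination this)

/-- The Koszul sign of exchanging two homogeneous elements. -/
def sg (a b : Σ i, E i) : 𝕜 := (-1) ^ (a.1 * b.1)

theorem sg_comm (a b : Σ i, E i) : sg 𝕜 a b = sg 𝕜 b a := by
  rw [sg, sg, mul_comm]

theorem sg_cases (a b : Σ i, E i) : sg 𝕜 a b = 1 ∨ sg 𝕜 a b = -1 := by
  rcases Int.even_or_odd (a.1 * b.1) with h | h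
  · exact Or.inl h.neg_one_zpow
  · exact Or.inr h.neg_one_zpow

theorem filter_isShuffle {n k : ℕ} {s : Finset (Equiv.Perm (Fin n))}
    (h : ∀ σ : Equiv.Perm (Fin n),
      (∀ i j : Fin n, i < j → ((j : ℕ) < k ∨ k ≤ (i : ℕ)) → σ i < σ j) ↔ σ ∈ s) :
    (Finset.univ.filter fun σ : Equiv.Perm (Fin n) => IsShuffle k σ) = s := by
  ext σ
  rw [Finset.mem_filter, ← h σ]
  exact and_iff_right (Finset.mem_univ σ)

theorem shuffles_two_one : (Finset.univ.filter fun σ : Equiv.Perm (Fin 2) => IsShuffle 1 σ) =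
    {1, Equiv.swap 0 1} :=
  filter_isShuffle (by decide)

theorem shuffles_two_two : (Finset.univ.filter fun σ : Equiv.Perm (Fin 2) => IsShuffle 2 σ) =
    {1} :=
  filter_isShuffle (by decide)

theorem shuffles_three_one : (Finset.univ.filter fun σ : Equiv.Perm (Fin 3) => IsShuffle 1 σ) =
    {1, Equiv.swap 0 1, Equiv.swap 0 2 * Equiv.swap 1 2} :=
  filter_isShuffle (by decide)

theorem shuffles_three_two : (Finset.univ.filter fun σ : Equiv.Perm (Fin 3) => IsShuffle 2 σ) =
    {1, Equiv.swap 1 2, Equiv.swap 0 1 * Equiv.swap 1 2} :=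
  filter_isShuffle (by decide)

theorem shuffles_three_three : (Finset.univ.filter fun σ : Equiv.Perm (Fin 3) => IsShuffle 3 σ) =
    {1} :=
  filter_isShuffle (by decide)

theorem koszulSign_eq_prod {n : ℕ} (y : Fin n → Σ i, E i) {σ : Equiv.Perm (Fin n)}
    {s : Finset (Fin n × Fin n)} (h : ∀ p, (p.1 < p.2 ∧ σ p.2 < σ p.1) ↔ p ∈ s) :
    koszulSign 𝕜 (fun j => (y j).1) σ = ∏ p ∈ s, sg 𝕜 (y (σ p.1)) (y (σ p.2)) :=
  Finset.prod_congr (by ext p; rw [← h p, Finset.mem_filter]; exact and_iff_right (Finset.mem_univ p))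
    fun _ _ => rfl

theorem koszulSign_one {n : ℕ} (y : Fin n → Σ i, E i) :
    koszulSign 𝕜 (fun j => (y j).1) 1 = 1 :=
  koszulSign_eq_prod 𝕜 y (s := ∅) fun _ =>
    ⟨fun h => absurd h.1 h.2.le.not_gt, fun h => absurd h (Finset.notMem_empty _)⟩

theorem ins_one {F : RawForm E} (hF : LowZero 1 F) (G : RawForm E) (a : Σ i, E i) :
    ev (ins 𝕜 E F G) ![a] = ap G (ev F ![a]) ![] := by
  rw [ev_ins, Fin.sum_univ_two]
  have h0 : insPart 𝕜 F G ![a] 0 (by omega) = 0 := by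
    simp [insPart, hF 0 (by omega)]
  have hs : (Finset.univ.filter fun σ : Equiv.Perm (Fin 1) => IsShuffle 1 σ) = {1} :=
      filter_isShuffle (by decide)
  have h1 : insPart 𝕜 F G ![a] 1 (by omega) = ap G (ev F ![a]) ![] := by
    rw [insPart, hs, Finset.sum_singleton, koszulSign_one, one_smul]
    congr 2
    funext i
    fin_cases i
  exact (congrArg₂ (· + ·) h0 h1).trans (zero_add _)

theorem ins_two {F : RawForm E} (hF : LowZero 1 F) (G : RawForm E) (a b : Σ i, E i) :
    ev (ins 𝕜 E F G) ![a, b] =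
      ap G (ev F ![a]) ![b] + sg 𝕜 a b • ap G (ev F ![b]) ![a] + ap G (ev F ![a, b]) ![] := by
  rw [ev_ins, Fin.sum_univ_three]
  have h0 : insPart 𝕜 F G ![a, b] 0 (by omega) = 0 := by
    simp [insPart, hF 0 (by omega)]
  have h1 : insPart 𝕜 F G ![a, b] 1 (by omega) =
      ap G (ev F ![a]) ![b] + sg 𝕜 a b • ap G (ev F ![b]) ![a] := by
    rw [insPart, shuffles_two_one, Finset.sum_pair (by decide)]
    have hk' : koszulSign 𝕜 (fun j => ((![a, b] : Fin 2 → Σ i, E i) j).1) (Equiv.swap 0 1) =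
        sg 𝕜 a b := by
      rw [koszulSign_eq_prod 𝕜 _ (s := {(0, 1)}) (by decide), Finset.prod_singleton]
      exact sg_comm 𝕜 b a
    rw [koszulSign_one, hk', one_smul]
    congr 1
    · congr 2 <;> (funext i; fin_cases i; rfl)
    · congr 3 <;> (funext i; fin_cases i; rfl)
  have h2 : insPart 𝕜 F G ![a, b] 2 (by omega) = ap G (ev F ![a, b]) ![] := by
    rw [insPart, shuffles_two_two, Finset.sum_singleton, koszulSign_one, one_smul]
    congr 2
    funext i
    fin_cases i
  refine (congrArg₂ (· + ·) (congrArg₂ (· + ·) h0 h1) h2).trans ?_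
  simp only [zero_add]

theorem ins_three {F : RawForm E} (hF : LowZero 1 F) (G : RawForm E) (a b c : Σ i, E i) :
    ev (ins 𝕜 E F G) ![a, b, c] =
      ap G (ev F ![a]) ![b, c] + sg 𝕜 a b • ap G (ev F ![b]) ![a, c] +
        (sg 𝕜 a c * sg 𝕜 b c) • ap G (ev F ![c]) ![a, b] +
      (ap G (ev F ![a, b]) ![c] + sg 𝕜 b c • ap G (ev F ![a, c]) ![b] +
        (sg 𝕜 a b * sg 𝕜 a c) • ap G (ev F ![b, c]) ![a]) +
      ap G (ev F ![a, b, c]) ![] := by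
  rw [ev_ins, Fin.sum_univ_four]
  have h0 : insPart 𝕜 F G ![a, b, c] 0 (by omega) = 0 := by
    simp [insPart, hF 0 (by omega)]
  have h1 : insPart 𝕜 F G ![a, b, c] 1 (by omega) =
      ap G (ev F ![a]) ![b, c] + sg 𝕜 a b • ap G (ev F ![b]) ![a, c] +
        (sg 𝕜 a c * sg 𝕜 b c) • ap G (ev F ![c]) ![a, b] := by
    rw [insPart, shuffles_three_one, Finset.sum_insert (by decide), Finset.sum_pair (by decide),
      ← add_assoc]
    have hk' : koszulSign 𝕜 (fun j => ((![a, b, c] : Fin 3 → Σ i, E i) j).1) (Equiv.swap 0 1) =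
        sg 𝕜 a b := by
      rw [koszulSign_eq_prod 𝕜 _ (s := {(0, 1)}) (by decide), Finset.prod_singleton]
      exact sg_comm 𝕜 b a
    have hk'' : koszulSign 𝕜 (fun j => ((![a, b, c] : Fin 3 → Σ i, E i) j).1)
        (Equiv.swap 0 2 * Equiv.swap 1 2) = sg 𝕜 a c * sg 𝕜 b c := by
      rw [koszulSign_eq_prod 𝕜 _ (s := {(0, 1), (0, 2)}) (by decide), Finset.prod_pair (by decide)]
      exact congrArg₂ (· * ·) (sg_comm 𝕜 c a) (sg_comm 𝕜 c b)
    rw [koszulSign_one, hk', hk'', one_smul]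
    congr 1
    · congr 1
      · congr 2 <;> (funext i; fin_cases i <;> rfl)
      · congr 3 <;> (funext i; fin_cases i <;> rfl)
    · congr 3 <;> (funext i; fin_cases i <;> rfl)
  have h2 : insPart 𝕜 F G ![a, b, c] 2 (by omega) =
      ap G (ev F ![a, b]) ![c] + sg 𝕜 b c • ap G (ev F ![a, c]) ![b] +
        (sg 𝕜 a b * sg 𝕜 a c) • ap G (ev F ![b, c]) ![a] := by
    rw [insPart, shuffles_three_two, Finset.sum_insert (by decide), Finset.sum_pair (by decide),
      ← add_assoc]
    have hk' : koszulSign 𝕜 (fun j => ((![a, b, c] : Fin 3 → Σ i, E i) j).1) (Equiv.swap 1 2) =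
        sg 𝕜 b c := by
      rw [koszulSign_eq_prod 𝕜 _ (s := {(1, 2)}) (by decide), Finset.prod_singleton]
      exact sg_comm 𝕜 c b
    have hk'' : koszulSign 𝕜 (fun j => ((![a, b, c] : Fin 3 → Σ i, E i) j).1)
        (Equiv.swap 0 1 * Equiv.swap 1 2) = sg 𝕜 a b * sg 𝕜 a c := by
      rw [koszulSign_eq_prod 𝕜 _ (s := {(0, 2), (1, 2)}) (by decide), Finset.prod_pair (by decide)]
      exact congrArg₂ (· * ·) (sg_comm 𝕜 b a) (sg_comm 𝕜 c a)
    rw [koszulSign_one, hk', hk'', one_smul]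
    congr 1
    · congr 1
      · congr 2 <;> (funext i; fin_cases i <;> rfl)
      · congr 3 <;> (funext i; fin_cases i <;> rfl)
    · congr 3 <;> (funext i; fin_cases i <;> rfl)
  have h3 : insPart 𝕜 F G ![a, b, c] 3 (by omega) = ap G (ev F ![a, b, c]) ![] := by
    rw [insPart, shuffles_three_three, Finset.sum_singleton, koszulSign_one, one_smul]
    congr 2
    funext i
    fin_cases i
  refine (congrArg₂ (· + ·) (congrArg₂ (· + ·) (congrArg₂ (· + ·) h0 h1) h2) h3).trans ?_
  simp only [zero_add]

/-- `F` is additive in each argument. -/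
def AddSlots (F : RawForm E) : Prop :=
  ∀ (n : ℕ) (y : Fin n → Σ i, E i) (j : Fin n) (m : ℤ) (a b : E m),
    ev F (Function.update y j ⟨m, a + b⟩) =
      ev F (Function.update y j ⟨m, a⟩) + ev F (Function.update y j ⟨m, b⟩)

section AddSlots

variable {𝕜}

theorem AddSlots.addHead {F : RawForm E} (hF : AddSlots F) : AddHead F := by
  intro n m a b rest
  have h := hF (n + 1) (Fin.cons ⟨m, 0⟩ rest) 0 m a b
  simpa only [Fin.update_cons_zero] using h

theorem AddSlots.ap_update {F : RawForm E} (hF : AddSlots F) (f : ⨁ i, E i) {n : ℕ}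
    (y : Fin n → Σ i, E i) (j : Fin n) (m : ℤ) (a b : E m) :
    ap F f (Function.update y j ⟨m, a + b⟩) =
      ap F f (Function.update y j ⟨m, a⟩) + ap F f (Function.update y j ⟨m, b⟩) := by
  simp only [ap, Fin.cons_update, hF _ _ _ m a b]
  exact DFinsupp.sum_add

theorem update_comp_of_injective {n k : ℕ} (y : Fin n → Σ i, E i) {e : Fin k → Fin n}
    (he : Function.Injective e) (i : Fin k) (z : Σ i, E i) :
    (fun i' => Function.update y (e i) z (e i')) = Function.update (fun i' => y (e i')) i z :=
  Function.update_comp_eq_of_injective y he i z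

theorem update_comp_of_ne {n k : ℕ} (y : Fin n → Σ i, E i) {e : Fin k → Fin n} {j : Fin n}
    (hj : ∀ i, e i ≠ j) (z : Σ i, E i) :
    (fun i' => Function.update y j z (e i')) = fun i' => y (e i') :=
  funext fun i' => Function.update_of_ne (hj i') z y

theorem AddSlots.ins {F G : RawForm E} (hF : AddSlots F) (hG : AddSlots G) :
    AddSlots (ins 𝕜 E F G) := by
  intro n y j m a b
  simp only [ev_ins, ← Finset.sum_add_distrib]
  refine Finset.sum_congr rfl fun k _ => ?_
  simp only [insPart, ← Finset.sum_add_distrib]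
  refine Finset.sum_congr rfl fun σ _ => ?_
  have hdeg : ∀ v : E m, (fun j' => (Function.update y j ⟨m, v⟩ j').1) =
      Function.update (fun j' => (y j').1) j m := by
    intro v
    funext j'
    rcases eq_or_ne j' j with rfl | h
    · simp
    · simp [h]
  rw [hdeg, hdeg, hdeg, ← smul_add]
  congr 1
  obtain ⟨i, rfl⟩ := σ.surjective j
  have hk : (k : ℕ) ≤ n := Nat.lt_succ_iff.mp k.isLt
  have hinj : Function.Injective fun i' : Fin k => σ ⟨i', i'.isLt.trans_le hk⟩ := by
    intro p q h
    simpa [Fin.ext_iff] using h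
  have hinj' : Function.Injective fun i' : Fin (n - k) =>
      σ ⟨k + i', by have := i'.isLt; omega⟩ := by
    intro p q h
    simpa [Fin.ext_iff] using h
  rcases lt_or_ge (i : ℕ) k with hi | hi
  · have hne : ∀ i' : Fin (n - k), σ ⟨k + i', by have := i'.isLt; omega⟩ ≠ σ i := by
      intro i' h
      have := congrArg Fin.val (σ.injective h)
      simp at this
      omega
    have h1 := fun z => update_comp_of_injective y hinj ⟨i, hi⟩ z
    have h2 := fun z => update_comp_of_ne y hne z
    simp only [Fin.eta] at h1
    simp only [h1, h2, hF _ _ _ m a b, hG.addHead.ap_add]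
  · have hne : ∀ i' : Fin k, σ ⟨i', i'.isLt.trans_le hk⟩ ≠ σ i := by
      intro i' h
      have := congrArg Fin.val (σ.injective h)
      have := i'.isLt
      simp at *
      omega
    have hik : (⟨(k : ℕ) + (i - k), by omega⟩ : Fin n) = i := Fin.ext (by simp; omega)
    have h1 := fun z => update_comp_of_ne y hne z
    have h2 := fun z => update_comp_of_injective y hinj' ⟨i - k, by omega⟩ z
    simp only [hik] at h2
    simp only [h1, h2, hG.ap_update _ _ _ m a b]

end AddSlots

/-- Graded symmetry under adjacent swaps, on two and on three arguments. -/
structure LowSym (F : RawForm E) : Prop where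
  two : ∀ a b, ev F ![b, a] = sg 𝕜 a b • ev F ![a, b]
  left : ∀ a b c, ev F ![b, a, c] = sg 𝕜 a b • ev F ![a, b, c]
  right : ∀ a b c, ev F ![a, c, b] = sg 𝕜 b c • ev F ![a, b, c]

/-- The properties of symmetric vector valued forms of degree `d` on a graded vector space
concentrated in degrees `-2` and `-1` that are used below. -/
structure Good (d : ℤ) (F : RawForm E) : Prop where
  low : LowZero 1 F
  deg : IsOfDeg E d F
  conc : Conc F
  add : AddSlots F
  sym : LowSym 𝕜 F

section Good

variable {𝕜}

theorem Good.head {d : ℤ} {F : RawForm E} (hF : Good 𝕜 d F) : AddHead F := hF.add.addHead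

theorem LowSym.ap_rest {G : RawForm E} (hG : LowSym 𝕜 G) (f : ⨁ i, E i) (a b : Σ i, E i) :
    ap G f ![b, a] = sg 𝕜 a b • ap G f ![a, b] := by
  have h : ∀ m (v : E m), ev G (Fin.cons (⟨m, v⟩ : Σ i, E i) ![b, a] : Fin 3 → Σ i, E i) =
      sg 𝕜 a b • ev G (Fin.cons (⟨m, v⟩ : Σ i, E i) ![a, b] : Fin 3 → Σ i, E i) :=
    fun m v => hG.right ⟨m, v⟩ a b
  simp only [ap, h]
  exact Finset.smul_sum.symm

theorem AddHead.ap_sg {G : RawForm E} (hG : AddHead G) (a b : Σ i, E i) (f : ⨁ i, E i) {n : ℕ}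
    (rest : Fin n → Σ i, E i) : ap G (sg 𝕜 a b • f) rest = sg 𝕜 a b • ap G f rest := by
  rcases sg_cases 𝕜 a b with h | h <;> simp [h, hG.ap_neg]

theorem Good.lowSym_ins {p q : ℤ} {F G : RawForm E} (hF : Good 𝕜 p F) (hG : Good 𝕜 q G) :
    LowSym 𝕜 (ins 𝕜 E F G) where
  two a b := by
    rw [ins_two 𝕜 hF.low, ins_two 𝕜 hF.low, hF.sym.two a b, hG.head.ap_sg, sg_comm 𝕜 b a]
    rcases sg_cases 𝕜 a b with h | h <;> rw [h] <;> module
  left a b c := by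
    rw [ins_three 𝕜 hF.low, ins_three 𝕜 hF.low, hF.sym.two a b, hF.sym.left a b c,
      hG.head.ap_sg, hG.head.ap_sg, hG.sym.ap_rest _ a b, sg_comm 𝕜 b a]
    rcases sg_cases 𝕜 a b with h | h <;> rw [h] <;> module
  right a b c := by
    rw [ins_three 𝕜 hF.low, ins_three 𝕜 hF.low, hF.sym.two b c, hF.sym.right a b c,
      hG.head.ap_sg, hG.head.ap_sg, hG.sym.ap_rest _ b c, sg_comm 𝕜 c b]
    rcases sg_cases 𝕜 b c with h | h <;> rw [h] <;> module

theorem Good.ins {p q : ℤ} {F G : RawForm E} (hF : Good 𝕜 p F) (hG : Good 𝕜 q G) :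
    Good 𝕜 (p + q) (ins 𝕜 E F G) where
  low := LowZero.ins 𝕜 hF.low hG.low
  deg := isOfDeg_ins 𝕜 hF.deg hG.deg
  conc := Conc.ins 𝕜 hF.conc hG.conc
  add := hF.add.ins hG.add
  sym := hF.lowSym_ins hG

theorem Good.add_form {p : ℤ} {F G : RawForm E} (hF : Good 𝕜 p F) (hG : Good 𝕜 p G) :
    Good 𝕜 p (F + G) where
  low n hn y := by rw [ev_add, hF.low n hn, hG.low n hn, add_zero]
  deg n ι x m hm := by
    change F n ι x m + G n ι x m = 0
    rw [hF.deg n ι x m hm, hG.deg n ι x m hm, add_zero]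
  conc n y j h2 h1 := by rw [ev_add, hF.conc n y j h2 h1, hG.conc n y j h2 h1, add_zero]
  add n y j m a b := by
    simp only [ev_add, hF.add n y j m a b, hG.add n y j m a b]
    abel
  sym :=
    { two := fun a b => by rw [ev_add, ev_add, hF.sym.two a b, hG.sym.two a b, smul_add]
      left := fun a b c => by
        rw [ev_add, ev_add, hF.sym.left a b c, hG.sym.left a b c, smul_add]
      right := fun a b c => by
        rw [ev_add, ev_add, hF.sym.right a b c, hG.sym.right a b c, smul_add] }

theorem ev_smul (c : 𝕜) (F : RawForm E) {n : ℕ} (y : Fin n → Σ i, E i) :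
    ev (c • F) y = c • ev F y := rfl

theorem Good.smul {p : ℤ} {F : RawForm E} (hF : Good 𝕜 p F) (c : 𝕜) : Good 𝕜 p (c • F) where
  low n hn y := by rw [ev_smul, hF.low n hn, smul_zero]
  deg n ι x m hm := by
    change (c • F n ι x) m = 0
    rw [DirectSum.smul_apply, hF.deg n ι x m hm, smul_zero]
  conc n y j h2 h1 := by rw [ev_smul, hF.conc n y j h2 h1, smul_zero]
  add n y j m a b := by simp only [ev_smul, hF.add n y j m a b, smul_add]
  sym :=
    { two := fun a b => by rw [ev_smul, ev_smul, hF.sym.two a b, smul_comm]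
      left := fun a b c => by rw [ev_smul, ev_smul, hF.sym.left a b c, smul_comm]
      right := fun a b c => by rw [ev_smul, ev_smul, hF.sym.right a b c, smul_comm] }

theorem rnb_zero_left (d : ℤ) (F G : RawForm E) :
    rnb 𝕜 E 0 d F G = ins 𝕜 E F G + (-1 : 𝕜) • ins 𝕜 E G F := by
  refine form_ext fun n y => ?_
  rw [ev_rnb, zero_mul, zpow_zero, one_smul, ev_add, ev_smul, neg_one_smul, sub_eq_add_neg]

theorem Good.rnb {q : ℤ} {F G : RawForm E} (hF : Good 𝕜 0 F) (hG : Good 𝕜 q G) :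
    Good 𝕜 q (rnb 𝕜 E 0 q F G) := by
  rw [rnb_zero_left]
  have h1 := hF.ins hG
  have h2 := hG.ins hF
  rw [zero_add] at h1
  rw [add_zero] at h2
  exact h1.add_form (h2.smul _)

theorem IsSVF.good (hE : ∀ i : ℤ, i ≠ -2 → i ≠ -1 → ∀ v : E i, v = 0) {d : ℤ} {F : RawForm E}
    (hF : IsSVF 𝕜 E d F) (h0 : LowZero 1 F) : Good 𝕜 d F where
  low := h0
  deg := hF.2.2
  conc n y j h2 h1 := by
    have h := (hF.1 n (fun j => (y j).1) (fun j => (y j).2) j 0 0 0).2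
    have hy : Function.update (fun j => (y j).2) j (0 : E (y j).1) = fun j => (y j).2 := by
      rw [← hE _ h2 h1 (y j).2]
      exact Function.update_eq_self j _
    rw [zero_smul, zero_smul, hy] at h
    exact h
  add n y j m a b := by
    have key : ∀ y : Fin n → Σ i, E i, (y j).1 = m → ∀ a b : E m,
        ev F (Function.update y j ⟨m, a + b⟩) =
          ev F (Function.update y j ⟨m, a⟩) + ev F (Function.update y j ⟨m, b⟩) := by
      rintro y rfl a b
      have hy : ∀ v : E (y j).1, Function.update y j ⟨(y j).1, v⟩ =
          fun i => ⟨(y i).1, Function.update (fun i => (y i).2) j v i⟩ := by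
        intro v
        funext i
        rcases eq_or_ne i j with rfl | h
        · simp
        · simp [h]
      rw [hy, hy, hy]
      exact (hF.1 n (fun i => (y i).1) (fun i => (y i).2) j a b 0).1
    simpa only [Function.update_idem] using key (Function.update y j ⟨m, 0⟩) (by simp) a b
  sym :=
    have key : ∀ {n : ℕ} (y : Fin n → Σ i, E i) (p q : Fin n), (p : ℕ) + 1 = q →
        ev F (fun j => y (Equiv.swap p q j)) = sg 𝕜 (y p) (y q) • ev F y :=
      fun y p q h => hF.2.1 _ _ (fun j => (y j).2) p q h
    { two := fun a b => by
        refine (congrArg (ev F) ?_).trans (key ![a, b] 0 1 rfl)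
        funext i; fin_cases i <;> rfl
      left := fun a b c => by
        refine (congrArg (ev F) ?_).trans (key ![a, b, c] 0 1 rfl)
        funext i; fin_cases i <;> rfl
      right := fun a b c => by
        refine (congrArg (ev F) ?_).trans (key ![a, b, c] 1 2 rfl)
        funext i; fin_cases i <;> rfl }

end Good

section Euler

variable {𝕜}

theorem ev_euler_one (a : Σ i, E i) :
    ev (euler E) ![a] = (-a.1) • DirectSum.of E a.1 a.2 := rfl

theorem ev_euler_of_ne {n : ℕ} (hn : n ≠ 1) (y : Fin n → Σ i, E i) : ev (euler E) y = 0 :=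
  dif_neg hn

theorem lowZero_euler : LowZero 1 (euler E) := fun _ hn y => ev_euler_of_ne hn.ne y

theorem ev_euler_of_eq {n : ℕ} (hn : n = 1) (y : Fin n → Σ i, E i) (j : Fin n) :
    ev (euler E) y = (-(y j).1) • DirectSum.of E (y j).1 (y j).2 := by
  subst hn
  obtain rfl : j = 0 := Subsingleton.elim _ _
  rfl

theorem addSlots_euler : AddSlots (euler E) := by
  intro n y j m a b
  by_cases hn : n = 1
  · have h : ∀ v : E m, ev (euler E) (Function.update y j ⟨m, v⟩) =
        (-m) • DirectSum.of E m v := by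
      intro v
      rw [ev_euler_of_eq hn _ j, Function.update_self]
    rw [h, h, h, map_add, smul_add]
  · simp only [ev_euler_of_ne hn, add_zero]

theorem good_euler (hE : ∀ i : ℤ, i ≠ -2 → i ≠ -1 → ∀ v : E i, v = 0) :
    Good 𝕜 0 (euler E) where
  low := lowZero_euler
  deg n ι x m hm := by
    change ev (euler E) (fun j => (⟨ι j, x j⟩ : Σ i, E i)) m = 0
    by_cases hn : n = 1
    · subst hn
      rw [ev_euler_of_eq rfl _ 0, DirectSum.smul_apply, DirectSum.of_eq_of_ne, smul_zero]
      simpa using hm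
    · rw [ev_euler_of_ne hn]
      rfl
  conc n y j h2 h1 := by
    by_cases hn : n = 1
    · rw [ev_euler_of_eq hn y j, hE _ h2 h1 (y j).2, map_zero, smul_zero]
    · exact ev_euler_of_ne hn y
  add := addSlots_euler
  sym :=
    { two := fun a b => by simp [ev_euler_of_ne]
      left := fun a b c => by simp [ev_euler_of_ne]
      right := fun a b c => by simp [ev_euler_of_ne] }

theorem eq_of_of_isOfDeg {F : RawForm E} {d : ℤ} (hF : IsOfDeg E d F) {n : ℕ}
    (y : Fin n → Σ i, E i) {m : ℤ} (hm : (∑ j, (y j).1) + d = m) :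
    ev F y = DirectSum.of E m (ev F y m) := by
  ext i
  by_cases hi : i = m
  · subst hi
    rw [DirectSum.of_eq_same]
  · rw [DirectSum.of_eq_of_ne _ _ _ hi, isOfDeg_ev hF _ (hm ▸ hi)]

theorem ap_euler {F : RawForm E} {d : ℤ}
    (hF : IsOfDeg E d F) {n : ℕ} (y : Fin n → Σ i, E i) :
    ap (euler E) (ev F y) ![] = (-((∑ j, (y j).1) + d)) • ev F y := by
  rw [eq_of_of_isOfDeg hF y rfl, addSlots_euler.addHead.ap_of]
  exact ev_euler_one _

theorem ap_euler_cons (f : ⨁ i, E i) {n : ℕ} (rest : Fin (n + 1) → Σ i, E i) :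
    ap (euler E) f rest = 0 := by
  simp [ap, ev_euler_of_ne, DFinsupp.sum]

theorem Good.ap_euler_left {d : ℤ} {G : RawForm E} (hG : Good 𝕜 d G) (a : Σ i, E i) {n : ℕ}
    (rest : Fin n → Σ i, E i) :
    ap G (ev (euler E) ![a]) rest =
      (-a.1) • ev G (Fin.cons a rest : Fin (n + 1) → Σ i, E i) := by
  rw [ev_euler_one, hG.head.ap_zsmul, hG.head.ap_of]

theorem Good.eq_zero_of_sum_le (hE : ∀ i : ℤ, i ≠ -2 → i ≠ -1 → ∀ v : E i, v = 0) {d : ℤ}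
    {F : RawForm E} (hF : Good 𝕜 d F) {n : ℕ} (y : Fin n → Σ i, E i)
    (hn : (∑ j, (y j).1) + d ≤ -3) : ev F y = 0 := by
  rw [eq_of_of_isOfDeg hF.deg y rfl, hE _ (by omega) (by omega) (ev F y _), map_zero]

theorem Good.eq_of_le_three (hE : ∀ i : ℤ, i ≠ -2 → i ≠ -1 → ∀ v : E i, v = 0) {d : ℤ}
    (hd : d ≤ 1) {F G : RawForm E} (hF : Good 𝕜 d F) (hG : Good 𝕜 d G)
    (h1 : ∀ a, ev F ![a] = ev G ![a]) (h2 : ∀ a b, ev F ![a, b] = ev G ![a, b])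
    (h3 : ∀ a b c, ev F ![a, b, c] = ev G ![a, b, c]) : F = G := by
  refine form_ext fun n y => ?_
  match n, y with
  | 0, y => rw [hF.low 0 one_pos, hG.low 0 one_pos]
  | 1, y => convert h1 (y 0) using 2 <;> (funext i; fin_cases i; rfl)
  | 2, y => convert h2 (y 0) (y 1) using 2 <;> (funext i; fin_cases i <;> rfl)
  | 3, y => convert h3 (y 0) (y 1) (y 2) using 2 <;> (funext i; fin_cases i <;> rfl)
  | n + 4, y =>
    by_cases hy : ∀ j, (y j).1 = -2 ∨ (y j).1 = -1
    · have hsum : (∑ j, (y j).1) ≤ -4 := by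
        have h := Finset.sum_le_card_nsmul Finset.univ (fun j => (y j).1) (-1)
          fun j _ => by rcases hy j with h | h <;> omega
        simp at h
        omega
      rw [hF.eq_zero_of_sum_le hE y (by omega), hG.eq_zero_of_sum_le hE y (by omega)]
    · push Not at hy
      obtain ⟨j, h2, h1⟩ := hy
      rw [hF.conc _ y j h2 h1, hG.conc _ y j h2 h1]

theorem Good.zsmul {p : ℤ} {F : RawForm E} (hF : Good 𝕜 p F) (c : ℤ) : Good 𝕜 p (c • F) := by
  have : c • F = (c : 𝕜) • F := by
    refine form_ext fun n y => ?_
    rw [ev_smul, Int.cast_smul_eq_zsmul]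
    rfl
  rw [this]
  exact hF.smul _

theorem ev_zsmul (c : ℤ) (F : RawForm E) {n : ℕ} (y : Fin n → Σ i, E i) :
    ev (c • F) y = c • ev F y := rfl

/-- The bracket with the Euler map multiplies a form by its degree. -/
theorem Good.rnb_euler (hE : ∀ i : ℤ, i ≠ -2 → i ≠ -1 → ∀ v : E i, v = 0) {d : ℤ}
    (hd : d ≤ 1) {F : RawForm E} (hF : Good 𝕜 d F) :
    RN.rnb 𝕜 E 0 d (euler E) F = d • F := by
  have hS : Good 𝕜 0 (euler E) := good_euler hE
  refine Good.eq_of_le_three hE hd (hS.rnb hF) (hF.zsmul d) (fun a => ?_) (fun a b => ?_)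
    fun a b c => ?_
  · rw [rnb_zero_left, ev_add, ev_smul, ev_zsmul, ins_one 𝕜 hS.low, ins_one 𝕜 hF.low,
      hF.ap_euler_left, ap_euler hF.deg]
    change -a.1 • ev F ![a] + _ = _
    simp
    module
  · rw [rnb_zero_left, ev_add, ev_smul, ev_zsmul, ins_two 𝕜 hS.low, ins_two 𝕜 hF.low,
      hF.ap_euler_left, hF.ap_euler_left, ap_euler hF.deg, ap_euler_cons, ap_euler_cons,
      ev_euler_of_ne (by decide), ap_zero]
    change -a.1 • ev F ![a, b] + sg 𝕜 a b • (-b.1 • ev F ![b, a]) + _ + _ = _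
    rw [hF.sym.two a b]
    rcases sg_cases 𝕜 a b with h | h <;> simp [h] <;> module
  · rw [rnb_zero_left, ev_add, ev_smul, ev_zsmul, ins_three 𝕜 hS.low, ins_three 𝕜 hF.low]
    simp only [hF.ap_euler_left, ap_euler hF.deg, ap_euler_cons,
      ev_euler_of_ne (show (2 : ℕ) ≠ 1 by decide), ev_euler_of_ne (show (3 : ℕ) ≠ 1 by decide),
      ap_zero]
    change -a.1 • ev F ![a, b, c] + sg 𝕜 a b • (-b.1 • ev F ![b, a, c]) +
      (sg 𝕜 a c * sg 𝕜 b c) • (-c.1 • ev F ![c, a, b]) + _ + _ + _ = _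
    rw [hF.sym.left a c b, hF.sym.right a b c, hF.sym.left a b c]
    rcases sg_cases 𝕜 a b with h | h <;> rcases sg_cases 𝕜 b c with h' | h' <;>
      rcases sg_cases 𝕜 a c with h'' | h'' <;> simp [h, h', h'', Fin.sum_univ_three] <;> module

end Euler

section Nijenhuis

variable {𝕜}

theorem Good.rnb_add_right {d : ℤ} {F : RawForm E} (hF : Good 𝕜 0 F) (G H : RawForm E) :
    RN.rnb 𝕜 E 0 d F (G + H) = RN.rnb 𝕜 E 0 d F G + RN.rnb 𝕜 E 0 d F H := by
  rw [rnb_zero_left, rnb_zero_left, rnb_zero_left, ins_add_right, ins_add_left 𝕜 _ _ hF.head,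
    smul_add]
  abel

theorem Good.rnb_add_left {d : ℤ} {G : RawForm E} (hG : Good 𝕜 d G) (F F' : RawForm E) :
    RN.rnb 𝕜 E 0 d (F + F') G = RN.rnb 𝕜 E 0 d F G + RN.rnb 𝕜 E 0 d F' G := by
  rw [rnb_zero_left, rnb_zero_left, rnb_zero_left, ins_add_right, ins_add_left 𝕜 _ _ hG.head,
    smul_add]
  abel

theorem rnb_self (F : RawForm E) : RN.rnb 𝕜 E 0 0 F F = 0 := by
  rw [rnb_zero_left, neg_one_smul, add_neg_cancel]

/-- `S + α` is Nijenhuis with square `S + 2α` iff `[α, [α, μ]] = 0`. -/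
theorem euler_add_nijenhuis_iff (hE : ∀ i : ℤ, i ≠ -2 → i ≠ -1 → ∀ v : E i, v = 0)
    {α μ : RawForm E} (hα : Good 𝕜 0 α) (hμ : Good 𝕜 1 μ) :
    (RN.rnb 𝕜 E 0 1 (euler E + α) (RN.rnb 𝕜 E 0 1 (euler E + α) μ) =
          RN.rnb 𝕜 E 0 1 (euler E + (2 : ℤ) • α) μ ∧
        RN.rnb 𝕜 E 0 0 (euler E + α) (euler E + (2 : ℤ) • α) = 0) ↔
      RN.rnb 𝕜 E 0 1 α (RN.rnb 𝕜 E 0 1 α μ) = 0 := by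
  have hS : Good 𝕜 0 (euler E) := good_euler hE
  have hN := hS.add_form hα
  have hB := hα.rnb hμ
  have h2 : euler E + (2 : ℤ) • α = euler E + α + α := by rw [two_zsmul, add_assoc]
  have hsq : RN.rnb 𝕜 E 0 0 (euler E + α) (euler E + α + α) = 0 := by
    rw [hN.rnb_add_right, rnb_self, hα.rnb_add_left, rnb_self, hα.rnb_euler hE zero_le_one,
      zero_smul, add_zero, add_zero]
  rw [h2, and_iff_left hsq, hμ.rnb_add_left, hμ.rnb_add_left, hμ.rnb_euler hE le_rfl, one_smul,
    hN.rnb_add_right, hμ.rnb_add_left, hμ.rnb_euler hE le_rfl, one_smul, hB.rnb_add_left,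
    hB.rnb_euler hE le_rfl, one_smul, ← add_assoc, add_eq_left]

theorem ap_nil_of_lowZero {G : RawForm E} (hG : LowZero 2 G) (f : ⨁ i, E i)
    (y : Fin 0 → Σ i, E i) : ap G f y = 0 := by
  simp [ap, hG 1 one_lt_two, DFinsupp.sum]

theorem sg_odd (X Y : E (-1)) : sg 𝕜 (⟨-1, X⟩ : Σ i, E i) ⟨-1, Y⟩ = -1 := by
  simp [sg]

theorem ev_odd_pair {α : RawForm E} (hα : IsOfDeg E 0 α) (X Y : E (-1)) :
    ev α ![⟨-1, X⟩, ⟨-1, Y⟩] = DirectSum.of E (-2) (a2 E α X Y) := by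
  have hy : (fun j : Fin 2 => (⟨-1, if (j : ℕ) = 0 then X else Y⟩ : Σ i, E i)) =
      ![⟨-1, X⟩, ⟨-1, Y⟩] := by
    funext j
    fin_cases j <;> rfl
  rw [← hy]
  exact eq_of_of_isOfDeg hα _ (by simp)

theorem ev_even {l : RawForm E} (hl : IsOfDeg E 1 l) (v : E (-2)) :
    ev l ![⟨-2, v⟩] = DirectSum.of E (-1) (d1 E l v) := by
  have hy : (fun _ : Fin 1 => (⟨-2, v⟩ : Σ i, E i)) = ![⟨-2, v⟩] := by
    funext j
    fin_cases j
    rfl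
  rw [← hy]
  exact eq_of_of_isOfDeg hl _ (by simp)

theorem Good.ev_odd (hE : ∀ i : ℤ, i ≠ -2 → i ≠ -1 → ∀ v : E i, v = 0) {μ : RawForm E}
    (hμ : Good 𝕜 1 μ) (X : E (-1)) : ev μ ![⟨-1, X⟩] = 0 := by
  rw [eq_of_of_isOfDeg hμ.deg _ (m := 0) (by simp), hE 0 (by norm_num) (by norm_num) (ev μ _ 0),
    map_zero]

section DoubleBracket

variable (hE : ∀ i : ℤ, i ≠ -2 → i ≠ -1 → ∀ v : E i, v = 0) {α μ : RawForm E}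
  (hα : Good 𝕜 0 α) (hα2 : LowZero 2 α) (hμ : Good 𝕜 1 μ)
include hE hα hα2 hμ

theorem rnb_odd_odd (X Y : E (-1)) :
    ev (RN.rnb 𝕜 E 0 1 α μ) ![⟨-1, X⟩, ⟨-1, Y⟩] =
      ap μ (ev α ![⟨-1, X⟩, ⟨-1, Y⟩]) ![] := by
  rw [rnb_zero_left, ev_add, ev_smul, ins_two 𝕜 hα.low, ins_two 𝕜 hμ.low]
  simp [hα2 1 one_lt_two, hμ.ev_odd hE, ap_nil_of_lowZero hα2]

theorem rnb_even_odd (v : E (-2)) (Z : E (-1)) :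
    ev (RN.rnb 𝕜 E 0 1 α μ) ![⟨-2, v⟩, ⟨-1, Z⟩] = -ap α (ev μ ![⟨-2, v⟩]) ![⟨-1, Z⟩] := by
  rw [rnb_zero_left, ev_add, ev_smul, ins_two 𝕜 hα.low, ins_two 𝕜 hμ.low,
    hα.eq_zero_of_sum_le hE ![⟨-2, v⟩, ⟨-1, Z⟩] (by simp)]
  simp [hα2 1 one_lt_two, hμ.ev_odd hE, ap_nil_of_lowZero hα2]

theorem rnb_rnb_odd (X Y Z : E (-1)) :
    ev (RN.rnb 𝕜 E 0 1 α (RN.rnb 𝕜 E 0 1 α μ)) ![⟨-1, X⟩, ⟨-1, Y⟩, ⟨-1, Z⟩] =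
      (-2 : 𝕜) • DirectSum.of E (-2) (a2 E α (d1 E μ (a2 E α X Y)) Z +
        a2 E α (d1 E μ (a2 E α Y Z)) X + a2 E α (d1 E μ (a2 E α Z X)) Y) := by
  have hB := hα.rnb hμ
  have hT : ∀ X Y Z : E (-1), ap α (ap μ (ev α ![⟨-1, X⟩, ⟨-1, Y⟩]) ![]) ![⟨-1, Z⟩] =
      DirectSum.of E (-2) (a2 E α (d1 E μ (a2 E α X Y)) Z) := by
    intro X Y Z
    rw [ev_odd_pair hα.deg, hμ.head.ap_of, ← ev_odd_pair hα.deg]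
    refine (congrArg (fun f => ap α f ![⟨-1, Z⟩]) (ev_even hμ.deg _)).trans ?_
    exact hα.head.ap_of _ _ _
  have hskew : ap α (ap μ (ev α ![⟨-1, X⟩, ⟨-1, Z⟩]) ![]) ![⟨-1, Y⟩] =
      -ap α (ap μ (ev α ![⟨-1, Z⟩, ⟨-1, X⟩]) ![]) ![⟨-1, Y⟩] := by
    rw [hα.sym.two ⟨-1, Z⟩ ⟨-1, X⟩, sg_odd, neg_one_smul, hμ.head.ap_neg, hα.head.ap_neg]
  have hBα : ∀ X Y Z : E (-1),
      ap (RN.rnb 𝕜 E 0 1 α μ) (ev α ![⟨-1, X⟩, ⟨-1, Y⟩]) ![⟨-1, Z⟩] =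
        -ap α (ap μ (ev α ![⟨-1, X⟩, ⟨-1, Y⟩]) ![]) ![⟨-1, Z⟩] := by
    intro X Y Z
    rw [ev_odd_pair hα.deg, hB.head.ap_of, hμ.head.ap_of]
    exact rnb_even_odd hE hα hα2 hμ _ Z
  rw [rnb_zero_left, ev_add, ev_smul, ins_three 𝕜 hα.low, ins_three 𝕜 hB.low,
    hα.eq_zero_of_sum_le hE ![⟨-1, X⟩, ⟨-1, Y⟩, ⟨-1, Z⟩] (by simp [Fin.sum_univ_three])]
  simp only [hα2 1 one_lt_two, hB.ev_odd hE, ap_nil_of_lowZero hα2, ap_zero, sg_odd,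
    rnb_odd_odd hE hα hα2 hμ, hBα, hskew, hT, map_add]
  module

theorem rnb_rnb_eq_zero_iff :
    RN.rnb 𝕜 E 0 1 α (RN.rnb 𝕜 E 0 1 α μ) = 0 ↔
      ∀ X Y Z : E (-1), ev (RN.rnb 𝕜 E 0 1 α (RN.rnb 𝕜 E 0 1 α μ))
        ![⟨-1, X⟩, ⟨-1, Y⟩, ⟨-1, Z⟩] = 0 := by
  refine ⟨fun h X Y Z => by rw [h, ev_zero], fun h => ?_⟩
  have hB := hα.rnb hμ
  have hB2 : LowZero 2 (RN.rnb 𝕜 E 0 1 α μ) := by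
    intro n hn y
    rw [rnb_zero_left, ev_add, ev_smul, LowZero.ins 𝕜 hα2 hμ.low n hn,
      LowZero.ins 𝕜 hμ.low hα2 n hn, smul_zero, add_zero]
  have hC := hα.rnb hB
  have hC3 : LowZero 3 (RN.rnb 𝕜 E 0 1 α (RN.rnb 𝕜 E 0 1 α μ)) := by
    intro n hn y
    rw [rnb_zero_left, ev_add, ev_smul, LowZero.ins 𝕜 hα2 hB2 n hn,
      LowZero.ins 𝕜 hB2 hα2 n hn, smul_zero, add_zero]
  rw [← zero_smul 𝕜 (RN.rnb 𝕜 E 0 1 α (RN.rnb 𝕜 E 0 1 α μ))]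
  refine hC.eq_of_le_three hE le_rfl (hC.smul 0) (fun a => ?_) (fun a b => ?_) fun a b c => ?_
  · rw [ev_smul, hC3 1 (by norm_num), smul_zero]
  · rw [ev_smul, hC3 2 (by norm_num), smul_zero]
  · rw [ev_smul, zero_smul]
    by_cases hy : ∀ j, (![a, b, c] j).1 = -2 ∨ (![a, b, c] j).1 = -1
    · have ha : a.1 = -2 ∨ a.1 = -1 := hy 0
      have hb : b.1 = -2 ∨ b.1 = -1 := hy 1
      have hc : c.1 = -2 ∨ c.1 = -1 := hy 2
      by_cases hs : a.1 + b.1 + c.1 + 1 ≤ -3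
      · exact hC.eq_zero_of_sum_le hE _ (by simpa [Fin.sum_univ_three] using hs)
      · obtain ⟨i, X⟩ := a
        obtain ⟨j, Y⟩ := b
        obtain ⟨k, Z⟩ := c
        dsimp only at ha hb hc hs
        obtain rfl : i = -1 := by omega
        obtain rfl : j = -1 := by omega
        obtain rfl : k = -1 := by omega
        exact h X Y Z
    · push Not at hy
      obtain ⟨j, h2, h1⟩ := hy
      exact hC.conc _ _ j h2 h1

end DoubleBracket

end Nijenhuis

theorem IsArity.lowZero {k : ℕ} {F : RawForm E} (hF : IsArity E k F) : LowZero k F :=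
  fun _ hn _ => hF _ hn.ne _ _

theorem LowZero.mono {p q : ℕ} {F : RawForm E} (hF : LowZero q F) (hpq : p ≤ q) : LowZero p F :=
  fun n hn => hF n (hn.trans_le hpq)

end Evaluation

/-- Let `μ = l₁ + l₂ + l₃` be a Lie 2-algebra structure on a graded vector
space `E = E_{-2} ⊕ E_{-1}` and `α` a symmetric vector valued 2-form of degree 0 on `E`.
Then `S + α` is a Nijenhuis vector valued form with respect to `μ` with square `S + 2α`
iff `α(l₁(α(X,Y)),Z) + α(l₁(α(Y,Z)),X) + α(l₁(α(Z,X)),Y) = 0` for all `X, Y, Z ∈ E_{-1}`. -/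
theorem statement17 (𝕜 : Type) [Field 𝕜] [CharZero 𝕜]
    (E : ℤ → Type) [∀ i, AddCommGroup (E i)] [∀ i, Module 𝕜 (E i)]
    (hconc : ∀ i : ℤ, i ≠ -2 → i ≠ -1 → ∀ v : E i, v = 0)
    (l1 l2 l3 : RawForm E)
    (h1 : IsSVF 𝕜 E 1 l1) (h1a : IsArity E 1 l1)
    (h2 : IsSVF 𝕜 E 1 l2) (h2a : IsArity E 2 l2)
    (h3 : IsSVF 𝕜 E 1 l3) (h3a : IsArity E 3 l3)
    (hμμ : rnb 𝕜 E 1 1 (l1 + l2 + l3) (l1 + l2 + l3) = 0)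
    (α : RawForm E) (hα : IsSVF 𝕜 E 0 α) (hαa : IsArity E 2 α) :
    (rnb 𝕜 E 0 1 (euler E + α) (rnb 𝕜 E 0 1 (euler E + α) (l1 + l2 + l3)) =
          rnb 𝕜 E 0 1 (euler E + (2 : ℤ) • α) (l1 + l2 + l3) ∧
        rnb 𝕜 E 0 0 (euler E + α) (euler E + (2 : ℤ) • α) = 0) ↔
      ∀ X Y Z : E (-1),
        a2 E α (d1 E l1 (a2 E α X Y)) Z + a2 E α (d1 E l1 (a2 E α Y Z)) X +
            a2 E α (d1 E l1 (a2 E α Z X)) Y = 0 := by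
  have g1 := h1.good hconc h1a.lowZero
  have g2 := h2.good hconc (h2a.lowZero.mono one_le_two)
  have g3 := h3.good hconc (h3a.lowZero.mono (by norm_num))
  have hα2 := hαa.lowZero
  have gα := hα.good hconc (hα2.mono one_le_two)
  have gμ := (g1.add_form g2).add_form g3
  have hd : ∀ v : E (-2), d1 E (l1 + l2 + l3) v = d1 E l1 v := by
    intro v
    change (l1 1 _ _ + l2 1 _ _ + l3 1 _ _) (-1) = _
    rw [h2a 1 (by norm_num), h3a 1 (by norm_num), add_zero, add_zero]
    rfl
  rw [euler_add_nijenhuis_iff hconc gα gμ, rnb_rnb_eq_zero_iff hconc gα hα2 gμ]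
  refine forall_congr' fun X => forall_congr' fun Y => forall_congr' fun Z => ?_
  rw [rnb_rnb_odd hconc gα hα2 gμ, hd, hd, hd, smul_eq_zero_iff_right (by norm_num),
    map_eq_zero_iff _ (DirectSum.of_injective (-2))]

end RN
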